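/- Let (M, ⊵, Emb, Proj) be a target for a factor system (M_I, ⊵, emb, proj). Define a ∼_i b iff there exist a_i, b_i ∈ M_i with a ⊵ a_i, b ⊵ b_i and a_i ≍ b_i, and define Pt_i := Emb_i ∘ Proj_i : M → M. Then (M, ∼_I, Pt_I) is a PER-set (with points P_i := Emb_i[M_i]); in particular Pt_i = Pt_i ∘ Pt_{i'} for i ≤ i'. Moreover Proj_i(Emb_i(a_i)) ≍ a_i for all a_i ∈ M_i. -/

import Mathlib

/-- A prefactor system over a directed preorder `I`: a family of sets `A i`
with relations `rel : A i' → A i → Prop` for `i ≤ i'`, reflexive at equal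
stages, satisfying the (Factor) property: `a' ≍ a ↔ a' ⊵ a` for `i ≤ i'`. -/
structure PrefactorSystem (I : Type*) [Preorder I] where
  /-- the family of sets -/
  A : I → Type*
  /-- the predecessor relation `⊵` -/
  rel : ∀ ⦃i i' : I⦄, i ≤ i' → A i' → A i → Prop
  refl : ∀ (i : I) (h : i ≤ i) (a : A i), rel h a a
  /-- the (Factor) property, with consistency `≍` spelled out -/
  factor : ∀ ⦃i i' : I⦄ (h : i ≤ i') (a' : A i') (a : A i),
    (∃ (k : I) (h1 : i' ≤ k) (h2 : i ≤ k) (c : A k), rel h1 c a' ∧ rel h2 c a) ↔ rel h a' a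

/-- Consistency `a ≍ b` of two elements of a system. -/
def PrefactorSystem.Cons {I : Type*} [Preorder I] (S : PrefactorSystem I)
    {i j : I} (a : S.A i) (b : S.A j) : Prop :=
  ∃ (k : I) (h1 : i ≤ k) (h2 : j ≤ k) (c : S.A k), S.rel h1 c a ∧ S.rel h2 c b

/-- A target `(M, ⊵)` for a prefactor system. -/
structure Target {I : Type*} [Preorder I] (F : Set (Set I)) (S : PrefactorSystem I) where
  /-- the carrier of the target -/
  M : Type*
  /-- the relation `a ⊵ a_i` between `M` and the stages -/
  R : ∀ i : I, M → S.A i → Prop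
  /-- `I_a ∈ 𝔉(I)` for every `a ∈ M` -/
  dense : ∀ a : M, {i | ∃ x, R i a x} ∈ F
  /-- `a ⊵ a_{i'}` and `a ⊵ a_i` imply `a_{i'} ⊵ a_i` for `i ≤ i'` -/
  compat : ∀ ⦃i i' : I⦄ (h : i ≤ i') (a : M) (x' : S.A i') (x : S.A i),
    R i' a x' → R i a x → S.rel h x' x

/-- The induced family of relations `a ∼_i b` on a target. -/
def Target.per {I : Type*} [Preorder I] {F : Set (Set I)} {S : PrefactorSystem I}
    (T : Target F S) (i : I) (a b : T.M) : Prop :=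
  ∃ (x y : S.A i), T.R i a x ∧ T.R i b y ∧ S.Cons x y

/-- A prefactor system with (coherent) embeddings. -/
structure PrefactorSystemEmb (I : Type*) [Preorder I] extends PrefactorSystem I where
  /-- the embeddings `emb_{i,i'} : A i → A i'` for `i ≤ i'` -/
  emb : ∀ ⦃i i' : I⦄, i ≤ i' → A i → A i'
  /-- the embeddings preserve consistency -/
  emb_pres : ∀ ⦃i i' : I⦄ (h : i ≤ i') (a b : A i),
    toPrefactorSystem.Cons a b → toPrefactorSystem.Cons (emb h a) (emb h b)
  /-- `emb_{i,i}(a) ≍ a` -/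
  emb_self : ∀ (i : I) (h : i ≤ i) (a : A i), toPrefactorSystem.Cons (emb h a) a
  /-- `emb_{i',i''}(emb_{i,i'}(a)) ≍ emb_{i,i''}(a)` -/
  emb_comp : ∀ ⦃i i' i'' : I⦄ (h1 : i ≤ i') (h2 : i' ≤ i'') (a : A i),
    toPrefactorSystem.Cons (emb h2 (emb h1 a)) (emb (h1.trans h2) a)
  /-- the coherence property (Emb) -/
  emb_rel : ∀ ⦃i i' i'' : I⦄ (h : i ≤ i') (h2 : i' ≤ i'') (a' : A i') (a : A i),
    rel h a' a → rel (h.trans h2) (emb h2 a') a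

/-- A target `(M, ⊵, Emb)` for a prefactor system with embeddings. -/
structure TargetEmb {I : Type*} [Preorder I] (F : Set (Set I)) (S : PrefactorSystemEmb I) where
  /-- the carrier of the target -/
  M : Type*
  /-- the relation `a ⊵ a_i` between `M` and the stages -/
  R : ∀ i : I, M → S.A i → Prop
  /-- `I_a ∈ 𝔉(I)` for every `a ∈ M` -/
  dense : ∀ a : M, {i | ∃ x, R i a x} ∈ F
  /-- `a ⊵ a_{i'}` and `a ⊵ a_i` imply `a_{i'} ⊵ a_i` for `i ≤ i'` -/
  compat : ∀ ⦃i i' : I⦄ (h : i ≤ i') (a : M) (x' : S.A i') (x : S.A i),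
    R i' a x' → R i a x → S.rel h x' x
  /-- the maps `Emb_i : A i → M` -/
  Emb : ∀ i : I, S.A i → M
  /-- `Emb_i` preserves consistency (consistency on the target being equality) -/
  Emb_pres : ∀ (i : I) (a b : S.A i), S.toPrefactorSystem.Cons a b → Emb i a = Emb i b
  /-- `Emb_{i'}(emb_{i,i'}(a)) = Emb_i(a)` -/
  Emb_comm : ∀ ⦃i i' : I⦄ (h : i ≤ i') (a : S.A i), Emb i' (S.emb h a) = Emb i a
  /-- `a' ⊵ a` implies `Emb_{i'}(a') ⊵ a` -/
  Emb_rel : ∀ ⦃i i' : I⦄ (h : i ≤ i') (a' : S.A i') (a : S.A i),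
    S.rel h a' a → R i (Emb i' a') a

/-- The induced family of relations `a ∼_i b` on a target. -/
def TargetEmb.per {I : Type*} [Preorder I] {F : Set (Set I)} {S : PrefactorSystemEmb I}
    (T : TargetEmb F S) (i : I) (a b : T.M) : Prop :=
  ∃ (x y : S.A i), T.R i a x ∧ T.R i b y ∧ S.toPrefactorSystem.Cons x y

/-- The induced point maps `pt_i(a) := Emb_i(a_i)` for some `a_i` with `a ⊵ a_i`
(junk value outside the domain `[i]`). -/
noncomputable def TargetEmb.pt {I : Type*} [Preorder I] {F : Set (Set I)}
    {S : PrefactorSystemEmb I} (T : TargetEmb F S) (i : I) (a : T.M) : T.M :=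
  letI := Classical.propDecidable (∃ x, T.R i a x)
  if h : ∃ x, T.R i a x then T.Emb i h.choose else a

/-- A factor system: a prefactor system with coherent embeddings and
projections forming a `≍`-embedding-projection pair. -/
structure FactorSystem (I : Type*) [Preorder I] extends PrefactorSystemEmb I where
  /-- the projections `proj_{i',i} : A i' → A i` for `i ≤ i'` -/
  proj : ∀ ⦃i i' : I⦄, i ≤ i' → A i' → A i
  /-- the projections preserve consistency -/
  proj_pres : ∀ ⦃i i' : I⦄ (h : i ≤ i') (a b : A i'),
    toPrefactorSystem.Cons a b → toPrefactorSystem.Cons (proj h a) (proj h b)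
  /-- `proj_{i,i}(a) ≍ a` -/
  proj_self : ∀ (i : I) (h : i ≤ i) (a : A i), toPrefactorSystem.Cons (proj h a) a
  /-- `proj_{i',i}(proj_{i'',i'}(a)) ≍ proj_{i'',i}(a)` -/
  proj_comp : ∀ ⦃i i' i'' : I⦄ (h1 : i ≤ i') (h2 : i' ≤ i'') (a : A i''),
    toPrefactorSystem.Cons (proj h1 (proj h2 a)) (proj (h1.trans h2) a)
  /-- embedding-projection pair: `proj_{i',i}(emb_{i,i'}(a)) ≍ a` -/
  proj_emb : ∀ ⦃i i' : I⦄ (h : i ≤ i') (a : A i),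
    toPrefactorSystem.Cons (proj h (emb h a)) a
  /-- the coherence property (Proj) -/
  proj_rel : ∀ ⦃i i' i'' : I⦄ (h : i ≤ i') (h2 : i' ≤ i'') (a'' : A i'') (a : A i),
    rel (h.trans h2) a'' a → rel h (proj h2 a'') a

/-- A target `(M, ⊵, Emb, Proj)` for a factor system. -/
structure TargetFactor {I : Type*} [Preorder I] (F : Set (Set I)) (S : FactorSystem I) where
  /-- the carrier of the target -/
  M : Type*
  /-- the relation `a ⊵ a_i` between `M` and the stages -/
  R : ∀ i : I, M → S.A i → Prop
  /-- `I_a ∈ 𝔉(I)` for every `a ∈ M` -/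
  dense : ∀ a : M, {i | ∃ x, R i a x} ∈ F
  /-- `a ⊵ a_{i'}` and `a ⊵ a_i` imply `a_{i'} ⊵ a_i` for `i ≤ i'` -/
  compat : ∀ ⦃i i' : I⦄ (h : i ≤ i') (a : M) (x' : S.A i') (x : S.A i),
    R i' a x' → R i a x → S.rel h x' x
  /-- the maps `Emb_i : A i → M` -/
  Emb : ∀ i : I, S.A i → M
  /-- `Emb_i` preserves consistency (consistency on the target being equality) -/
  Emb_pres : ∀ (i : I) (a b : S.A i),
    S.toPrefactorSystemEmb.toPrefactorSystem.Cons a b → Emb i a = Emb i b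
  /-- `Emb_{i'}(emb_{i,i'}(a)) = Emb_i(a)` -/
  Emb_comm : ∀ ⦃i i' : I⦄ (h : i ≤ i') (a : S.A i), Emb i' (S.emb h a) = Emb i a
  /-- `a' ⊵ a` implies `Emb_{i'}(a') ⊵ a` -/
  Emb_rel : ∀ ⦃i i' : I⦄ (h : i ≤ i') (a' : S.A i') (a : S.A i),
    S.rel h a' a → R i (Emb i' a') a
  /-- the maps `Proj_i : M → A i` -/
  Proj : ∀ i : I, M → S.A i
  /-- `proj_{i',i}(Proj_{i'}(a)) ≍ Proj_i(a)` -/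
  Proj_coh : ∀ ⦃i i' : I⦄ (h : i ≤ i') (a : M),
    S.toPrefactorSystemEmb.toPrefactorSystem.Cons (S.proj h (Proj i' a)) (Proj i a)
  /-- `a ⊵ a_i` implies `Proj_{i'}(a) ⊵ a_i` for `i ≤ i'` -/
  Proj_rel : ∀ ⦃i i' : I⦄ (h : i ≤ i') (a : M) (x : S.A i),
    R i a x → S.rel h (Proj i' a) x

/-- The induced family of relations `a ∼_i b` on a target. -/
def TargetFactor.per {I : Type*} [Preorder I] {F : Set (Set I)} {S : FactorSystem I}
    (T : TargetFactor F S) (i : I) (a b : T.M) : Prop :=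
  ∃ (x y : S.A i), T.R i a x ∧ T.R i b y ∧ S.toPrefactorSystemEmb.toPrefactorSystem.Cons x y

/-- The induced total point maps `Pt_i := Emb_i ∘ Proj_i`. -/
def TargetFactor.Pt {I : Type*} [Preorder I] {F : Set (Set I)} {S : FactorSystem I}
    (T : TargetFactor F S) (i : I) (a : T.M) : T.M :=
  T.Emb i (T.Proj i a)

namespace PrefactorSystem

variable {I : Type*} [Preorder I] (S : PrefactorSystem I)

theorem cons_iff_rel {i i' : I} (h : i ≤ i') (a' : S.A i') (a : S.A i) :
    S.Cons a' a ↔ S.rel h a' a :=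
  S.factor h a' a

variable {S}

theorem Cons.refl {i : I} (a : S.A i) : S.Cons a a :=
  ⟨i, le_rfl, le_rfl, a, S.refl i _ a, S.refl i _ a⟩

theorem Cons.symm {i j : I} {a : S.A i} {b : S.A j} (h : S.Cons a b) : S.Cons b a := by
  obtain ⟨k, h1, h2, c, hca, hcb⟩ := h
  exact ⟨k, h2, h1, c, hcb, hca⟩

/-- Consistency is transitive through an intermediate element of a later stage. -/
theorem Cons.trans_of_le {i j k : I} (hi : i ≤ j) (hk : k ≤ j) {a : S.A i} {b : S.A j}
    {c : S.A k} (hab : S.Cons a b) (hbc : S.Cons b c) : S.Cons a c :=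
  ⟨j, hi, hk, b, (S.cons_iff_rel hi b a).1 hab.symm, (S.cons_iff_rel hk b c).1 hbc⟩

theorem Cons.trans {i : I} {a b c : S.A i} (hab : S.Cons a b) (hbc : S.Cons b c) :
    S.Cons a c :=
  hab.trans_of_le le_rfl le_rfl hbc

end PrefactorSystem

namespace TargetFactor

variable {I : Type*} [Preorder I] {F : Set (Set I)} {S : FactorSystem I} (T : TargetFactor F S)

theorem cons_of_R {i i' : I} (h : i ≤ i') {a : T.M} {x' : S.A i'} {x : S.A i}
    (hx' : T.R i' a x') (hx : T.R i a x) : S.Cons x' x :=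
  (S.cons_iff_rel h x' x).2 (T.compat h a x' x hx' hx)

theorem R_Emb (i : I) (x : S.A i) : T.R i (T.Emb i x) x :=
  T.Emb_rel le_rfl x x (S.refl i _ x)

theorem Proj_cons {i : I} {a : T.M} {x : S.A i} (hx : T.R i a x) : S.Cons (T.Proj i a) x :=
  (S.cons_iff_rel le_rfl _ _).2 (T.Proj_rel le_rfl a x hx)

theorem Proj_Emb_cons (i : I) (x : S.A i) : S.Cons (T.Proj i (T.Emb i x)) x :=
  T.Proj_cons (T.R_Emb i x)

theorem per_self_iff {i : I} {a : T.M} : T.per i a a ↔ ∃ x, T.R i a x :=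
  ⟨fun ⟨x, _, hx, _⟩ => ⟨x, hx⟩, fun ⟨x, hx⟩ => ⟨x, x, hx, hx, .refl x⟩⟩

theorem Pt_Pt {i i' : I} (h : i ≤ i') (a : T.M) : T.Pt i (T.Pt i' a) = T.Pt i a :=
  T.Emb_pres i _ _ <| (T.Proj_coh h _).symm.trans <|
    (S.proj_pres h _ _ (T.Proj_Emb_cons i' _)).trans (T.Proj_coh h a)

theorem per_of_le {i i' : I} (h : i ≤ i') {a b : T.M} (hab : T.per i' a b)
    (ha : T.per i a a) (hb : T.per i b b) : T.per i a b := by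
  obtain ⟨x', y', hx', hy', hxy'⟩ := hab
  obtain ⟨x, hx⟩ := T.per_self_iff.1 ha
  obtain ⟨y, hy⟩ := T.per_self_iff.1 hb
  exact ⟨x, y, hx, hy, (T.cons_of_R h hx' hx).symm.trans_of_le h h
    (hxy'.trans_of_le le_rfl h (T.cons_of_R h hy' hy))⟩

end TargetFactor

/-- for a target `(M, ⊵, Emb, Proj)` of a factor system, with
`a ∼_i b` defined via consistent approximations and `Pt_i := Emb_i ∘ Proj_i`,
`(M, ∼, Pt)` is a PER-set with points `P_i := Emb_i[A i]`; in particular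
`Pt_i = Pt_i ∘ Pt_{i'}` for `i ≤ i'`.  Moreover `Proj_i(Emb_i(a)) ≍ a` for
all `a ∈ A i`. -/
theorem stmt12 {I : Type*} [Preorder I] [Nonempty I] [IsDirected I (· ≤ ·)]
    {F : Set (Set I)} (hcof : ∀ H ∈ F, ∀ i : I, ∃ j ∈ H, i ≤ j)
    {S : FactorSystem I} (T : TargetFactor F S) :
    -- each `∼_i` is a partial equivalence relation
    (∀ (i : I) (a b : T.M), T.per i a b → T.per i b a) ∧
    (∀ (i : I) (a b c : T.M), T.per i a b → T.per i b c → T.per i a c) ∧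
    -- density
    (∀ a : T.M, {i | T.per i a a} ∈ F) ∧
    -- approximating
    (∀ ⦃i i' : I⦄, i ≤ i' → ∀ a b : T.M,
      T.per i' a b → T.per i a a → T.per i b b → T.per i a b) ∧
    -- `Pt_i` is a total map into `P_i`
    (∀ (i : I) (a : T.M), T.Pt i a ∈ Set.range (T.Emb i)) ∧
    -- its restriction `pt_i : [i] → P_i` is surjective
    (∀ i : I, ∀ p ∈ Set.range (T.Emb i), ∃ a : T.M, T.per i a a ∧ T.Pt i a = p) ∧
    -- `P_i ⊆ P_{i'}` for `i ≤ i'`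
    (∀ ⦃i i' : I⦄, i ≤ i' → Set.range (T.Emb i) ⊆ Set.range (T.Emb i')) ∧
    -- `a ∼_i b` implies `a ∼_i Pt_i(a)` and `Pt_i(a) = Pt_i(b)`
    (∀ (i : I) (a b : T.M), T.per i a b → T.per i a (T.Pt i a) ∧ T.Pt i a = T.Pt i b) ∧
    -- `Pt_i = Pt_i ∘ Pt_{i'}` for `i ≤ i'`
    (∀ ⦃i i' : I⦄, i ≤ i' → ∀ a : T.M, T.Pt i (T.Pt i' a) = T.Pt i a) ∧
    -- `a ∈ [i]` implies `Pt_{i'}(a) ∈ [i]` for `i ≤ i'`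
    (∀ ⦃i i' : I⦄, i ≤ i' → ∀ a : T.M, T.per i a a → T.per i (T.Pt i' a) (T.Pt i' a)) ∧
    -- moreover: `Proj_i(Emb_i(a)) ≍ a`
    (∀ (i : I) (a : S.A i),
      S.toPrefactorSystemEmb.toPrefactorSystem.Cons (T.Proj i (T.Emb i a)) a) := by
  refine ⟨?_, ?_, ?_, fun _ _ h _ _ => T.per_of_le h, fun i a => ⟨T.Proj i a, rfl⟩, ?_, ?_, ?_,
    fun _ _ h => T.Pt_Pt h, ?_, T.Proj_Emb_cons⟩
  · rintro i a b ⟨x, y, hx, hy, hxy⟩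
    exact ⟨y, x, hy, hx, hxy.symm⟩
  · rintro i a b c ⟨x, y, hx, hy, hxy⟩ ⟨y', z, hy', hz, hyz⟩
    exact ⟨x, z, hx, hz, hxy.trans ((T.cons_of_R le_rfl hy hy').trans hyz)⟩
  · intro a
    simpa only [T.per_self_iff] using T.dense a
  · rintro i _ ⟨x, rfl⟩
    exact ⟨T.Emb i x, T.per_self_iff.2 ⟨x, T.R_Emb i x⟩, T.Emb_pres i _ _ (T.Proj_Emb_cons i x)⟩
  · rintro i i' h _ ⟨x, rfl⟩
    exact ⟨S.emb h x, T.Emb_comm h x⟩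
  · rintro i a b ⟨x, y, hx, hy, hxy⟩
    exact ⟨⟨x, T.Proj i a, hx, T.R_Emb i _, (T.Proj_cons hx).symm⟩,
      T.Emb_pres i _ _ ((T.Proj_cons hx).trans (hxy.trans (T.Proj_cons hy).symm))⟩
  · intro i i' h a ha
    obtain ⟨x, hx⟩ := T.per_self_iff.1 ha
    exact T.per_self_iff.2 ⟨x, T.Emb_rel h _ x (T.Proj_rel h a x hx)⟩
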